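/- Assume ν > −1/2. There exists a constant C, independent of j, such that for every integer j ≥ 1 and every f ∈ L¹(I_j**, μ) (extended by zero outside I_j**), ∫_{I_j**} sup_{μ(I_j**) < t < 1} |𝒫_t f(x)| dμ(x) ≤ C ∫_{I_j**} |f(y)| dμ(y). -/

import Mathlib

open MeasureTheory Real Set Filter Topology
open scoped ENNReal NNReal

/-- Bessel function of the first kind of order `ν` (defined by its power series). -/
noncomputable def besselJ (ν x : ℝ) : ℝ :=
  ∑' m : ℕ, ((-1 : ℝ) ^ m / ((m.factorial : ℝ) * Real.Gamma ((m : ℝ) + ν + 1))) *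
    (x / 2) ^ (2 * (m : ℝ) + ν)

/-- `Λ` enumerates the successive positive zeros of `J_ν`, in increasing order,
`Λ n` corresponding to `λ_{n+1,ν}`. -/
def IsPositiveZerosOfBesselJ (ν : ℝ) (Λ : ℕ → ℝ) : Prop :=
  StrictMono Λ ∧ (∀ n, 0 < Λ n) ∧ (∀ n, besselJ ν (Λ n) = 0) ∧
    ∀ x : ℝ, 0 < x → besselJ ν x = 0 → ∃ n, Λ n = x

/-- The eigenfunctions `φ_n^ν`. -/
noncomputable def phiFB (ν : ℝ) (Λ : ℕ → ℝ) (n : ℕ) (x : ℝ) : ℝ :=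
  (Real.sqrt 2 / |Λ n * besselJ (ν + 1) (Λ n)|) * Real.sqrt (Λ n) *
    besselJ ν (Λ n * x) * x ^ (-ν)

/-- The Fourier–Bessel Poisson kernel `𝒫_t(x,y)`. -/
noncomputable def pKer (ν : ℝ) (Λ : ℕ → ℝ) (t x y : ℝ) : ℝ :=
  ∑' n : ℕ, Real.exp (-t * Λ n) * phiFB ν Λ n x * phiFB ν Λ n y

/-- The kernel `P_t(x,y) = (xy)^{ν+1/2} 𝒫_t(x,y)`. -/
noncomputable def pKerL (ν : ℝ) (Λ : ℕ → ℝ) (t x y : ℝ) : ℝ :=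
  (x * y) ^ (ν + 1/2) * pKer ν Λ t x y

/-- The measure `dμ(x) = x^{2ν+1} dx` on `(0,1)`. -/
noncomputable def muMeas (ν : ℝ) : Measure ℝ :=
  (volume.restrict (Ioo 0 1)).withDensity fun x => ENNReal.ofReal (x ^ (2 * ν + 1))

noncomputable def pI (j : ℕ) : ℝ := 1 - (1/2 : ℝ) ^ j
noncomputable def qI (j : ℕ) : ℝ := 1 - (1/2 : ℝ) ^ (j + 1)

/-- The `s`-dilate (same center, `s` times the length) of `(p,q]`, intersected with `(0,1)`. -/
def starSet (s p q : ℝ) : Set ℝ :=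
  Ioc ((p + q)/2 - s * (q - p)/2) ((p + q)/2 + s * (q - p)/2) ∩ Ioo 0 1

noncomputable def Istar (j : ℕ) : Set ℝ := starSet (51/50) (pI j) (qI j)
noncomputable def Istar2 (j : ℕ) : Set ℝ := starSet ((51/50)^2) (pI j) (qI j)

noncomputable def pJ (j : ℤ) : ℝ := if 1 ≤ j then 1 - (2:ℝ) ^ (-j) else (2:ℝ) ^ (j - 1)
noncomputable def qJ (j : ℤ) : ℝ := if 1 ≤ j then 1 - (2:ℝ) ^ (-j - 1) else (2:ℝ) ^ j

noncomputable def Jstar (j : ℤ) : Set ℝ := starSet (51/50) (pJ j) (qJ j)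
noncomputable def Jstar2 (j : ℤ) : Set ℝ := starSet ((51/50)^2) (pJ j) (qJ j)

/-- Modified Bessel function of the first kind. -/
noncomputable def besselI (ν x : ℝ) : ℝ :=
  ∑' m : ℕ, (1 / ((m.factorial : ℝ) * Real.Gamma ((m : ℝ) + ν + 1))) *
    (x / 2) ^ (2 * (m : ℝ) + ν)

/-- The Bessel heat kernel `𝐓_t(x,y)` on `(0,∞)`. -/
noncomputable def bHeatKer (ν t x y : ℝ) : ℝ :=
  (2*t)⁻¹ * Real.exp (-(x^2 + y^2)/(4*t)) * besselI ν (x*y/(2*t)) * (x*y) ^ (-ν)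

/-- The Fourier–Bessel heat kernel `𝒯_t(x,y)` on `(0,1)`. -/
noncomputable def fbHeatKer (ν : ℝ) (Λ : ℕ → ℝ) (t x y : ℝ) : ℝ :=
  ∑' n : ℕ, Real.exp (-t * (Λ n)^2) * phiFB ν Λ n x * phiFB ν Λ n y

/-- The entire function `F_μ` with `J_μ(x) = (x/2)^μ F_μ(x²/4)` for `x > 0`. -/
noncomputable def besselEntire (μ z : ℝ) : ℝ :=
  ∑' m : ℕ, ((-1 : ℝ) ^ m / ((m.factorial : ℝ) * Real.Gamma ((m : ℝ) + μ + 1))) * z ^ m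

lemma exists_pos_le_Gamma_nat_add {μ : ℝ} (hμ : -1 < μ) :
    ∃ δ : ℝ, 0 < δ ∧ ∀ m : ℕ, δ ≤ Real.Gamma ((m : ℝ) + μ + 1) := by
  have h0 : 0 < Real.Gamma (μ + 1) := Real.Gamma_pos_of_pos (by linarith)
  have h1 : 0 < Real.Gamma (μ + 1 + 1) := Real.Gamma_pos_of_pos (by linarith)
  have key : ∀ m : ℕ, Real.Gamma (μ + 1 + 1) ≤ Real.Gamma (((m + 1 : ℕ) : ℝ) + μ + 1) := by
    intro m
    induction m with
    | zero => apply le_of_eq; congr 1; push_cast; ring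
    | succ k ih =>
      have hk : (0 : ℝ) ≤ k := k.cast_nonneg
      have hx : (((k + 1 + 1 : ℕ) : ℝ) + μ + 1) = (((k + 1 : ℕ) : ℝ) + μ + 1) + 1 := by
        push_cast; ring
      rw [hx, Real.Gamma_add_one (s := ((k + 1 : ℕ) : ℝ) + μ + 1) (by push_cast; linarith)]
      refine ih.trans (le_mul_of_one_le_left (h1.le.trans ih) ?_)
      push_cast; linarith
  refine ⟨min (Real.Gamma (μ + 1)) (Real.Gamma (μ + 1 + 1)), lt_min h0 h1, fun m => ?_⟩
  cases m with
  | zero => simp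
  | succ k => exact (min_le_right _ _).trans (key k)

lemma summable_besselEntire {μ : ℝ} (hμ : -1 < μ) (z : ℝ) :
    Summable fun m : ℕ =>
      ((-1 : ℝ) ^ m / ((m.factorial : ℝ) * Real.Gamma ((m : ℝ) + μ + 1))) * z ^ m := by
  obtain ⟨δ, hδ, h⟩ := exists_pos_le_Gamma_nat_add hμ
  refine Summable.of_norm_bounded ((Real.summable_pow_div_factorial |z|).mul_left δ⁻¹) fun m => ?_
  have hG := hδ.trans_le (h m)
  have hf : (0 : ℝ) < m.factorial := by positivity
  rw [norm_mul, norm_div, norm_mul, norm_pow, norm_pow, norm_neg, norm_one, one_pow,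
    Real.norm_of_nonneg hf.le, Real.norm_of_nonneg hG.le, Real.norm_eq_abs]
  calc 1 / (m.factorial * Real.Gamma (m + μ + 1)) * |z| ^ m
      ≤ 1 / (m.factorial * δ) * |z| ^ m := by gcongr; exact h m
    _ = δ⁻¹ * (|z| ^ m / m.factorial) := by field_simp

lemma hasDerivAt_besselEntire {μ : ℝ} (hμ : -1 < μ) (z : ℝ) :
    HasDerivAt (besselEntire μ) (-besselEntire (μ + 1) z) z := by
  obtain ⟨δ, hδ, h⟩ := exists_pos_le_Gamma_nat_add hμ
  set R := |z| + 1
  have hR : 0 ≤ R := by positivity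
  set c : ℕ → ℝ := fun m => (-1 : ℝ) ^ m / ((m.factorial : ℝ) * Real.Gamma ((m : ℝ) + μ + 1))
  have hbound : Summable fun m : ℕ => δ⁻¹ * ((m : ℝ) * R ^ (m - 1) / m.factorial) := by
    refine Summable.mul_left _ ((summable_nat_add_iff 1).1 ?_)
    refine (Real.summable_pow_div_factorial R).congr fun m => ?_
    rw [Nat.factorial_succ, Nat.add_sub_cancel]
    push_cast
    field_simp
  have hz : z ∈ Metric.ball (0 : ℝ) R := by simp [R]
  have hd := hasDerivAt_tsum_of_isPreconnected (g := fun m y => c m * y ^ m)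
    (g' := fun m y => c m * (m * y ^ (m - 1))) hbound Metric.isOpen_ball
    (convex_ball (0 : ℝ) R).isPreconnected
    (fun m y _ => (hasDerivAt_pow m y).const_mul (c m))
    (fun m y hy => by
      have hy' : |y| ≤ R := by simpa using (Metric.mem_ball.1 hy).le
      have hG := hδ.trans_le (h m)
      have hf : (0 : ℝ) < m.factorial := by positivity
      simp only [c]
      rw [norm_mul, norm_div, norm_mul, norm_mul, norm_pow, norm_pow, norm_neg, norm_one, one_pow,
        Real.norm_of_nonneg hf.le, Real.norm_of_nonneg hG.le, Real.norm_eq_abs y,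
        Real.norm_of_nonneg (Nat.cast_nonneg m)]
      calc 1 / (m.factorial * Real.Gamma (m + μ + 1)) * (m * |y| ^ (m - 1))
          ≤ 1 / (m.factorial * δ) * (m * R ^ (m - 1)) := by gcongr; exact h m
        _ = _ := by field_simp)
    hz (summable_besselEntire hμ z) hz
  refine HasDerivAt.congr_deriv (f := besselEntire μ) hd ?_
  rw [besselEntire, ← tsum_neg]
  have hs : Summable fun m : ℕ => c m * (m * z ^ (m - 1)) := by
    refine (summable_nat_add_iff 1).1 ?_
    refine (summable_besselEntire (μ := μ + 1) (by linarith) z).neg.congr fun m => ?_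
    simp only [c]
    rw [Nat.factorial_succ, Nat.add_sub_cancel]
    push_cast
    rw [show (m : ℝ) + 1 + μ + 1 = m + (μ + 1) + 1 by ring, pow_succ]
    have : ((m : ℝ) + 1) ≠ 0 := by positivity
    field_simp
  rw [hs.tsum_eq_zero_add]
  simp only [Nat.cast_zero, zero_mul, mul_zero, zero_add]
  refine tsum_congr fun m => ?_
  simp only [c]
  rw [Nat.factorial_succ, Nat.add_sub_cancel]
  push_cast
  rw [show (m : ℝ) + 1 + μ + 1 = m + (μ + 1) + 1 by ring, pow_succ]
  have : ((m : ℝ) + 1) ≠ 0 := by positivity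
  field_simp

lemma besselEntire_recurrence {μ : ℝ} (hμ : -1 < μ) (z : ℝ) :
    besselEntire μ z = (μ + 1) * besselEntire (μ + 1) z - z * besselEntire (μ + 2) z := by
  have h1 := summable_besselEntire (μ := μ + 1) (by linarith) z
  have h2 := summable_besselEntire (μ := μ + 2) (by linarith) z
  have h0 := summable_besselEntire hμ z
  unfold besselEntire
  rw [← tsum_mul_left, ← tsum_mul_left, h0.tsum_eq_zero_add,
    (h1.mul_left (μ + 1)).tsum_eq_zero_add]
  have h1' := (summable_nat_add_iff 1).2 (h1.mul_left (μ + 1))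
  rw [add_sub_assoc, ← h1'.tsum_sub (h2.mul_left z)]
  have hG : Real.Gamma (μ + 1 + 1) = (μ + 1) * Real.Gamma (μ + 1) :=
    Real.Gamma_add_one (by linarith)
  have hμ1 : μ + 1 ≠ 0 := by linarith
  have hG0 : Real.Gamma (μ + 1) ≠ 0 := (Real.Gamma_pos_of_pos (by linarith)).ne'
  congr 1
  · simp only [Nat.factorial_zero, Nat.cast_zero, Nat.cast_one, pow_zero, zero_add]
    rw [hG]; field_simp
  · refine tsum_congr fun m => ?_
    have hm : (0 : ℝ) ≤ m := m.cast_nonneg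
    have hpos : 0 < (m : ℝ) + 1 + μ + 1 := by linarith
    have hGm : Real.Gamma ((m : ℝ) + 1 + (μ + 1) + 1) =
        ((m : ℝ) + 1 + μ + 1) * Real.Gamma ((m : ℝ) + 1 + μ + 1) := by
      rw [← Real.Gamma_add_one hpos.ne']; congr 1; ring
    have hGm0 : Real.Gamma ((m : ℝ) + 1 + μ + 1) ≠ 0 := (Real.Gamma_pos_of_pos hpos).ne'
    rw [Nat.factorial_succ]
    push_cast
    rw [show (m : ℝ) + (μ + 2) + 1 = m + 1 + (μ + 1) + 1 by ring, hGm, pow_succ, pow_succ]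
    have : ((m : ℝ) + 1) ≠ 0 := by positivity
    have := hpos.ne'
    field_simp
    ring

lemma besselJ_eq_besselEntire (μ : ℝ) {x : ℝ} (hx : 0 < x) :
    besselJ μ x = (x / 2) ^ μ * besselEntire μ (x ^ 2 / 4) := by
  have hx2 : 0 < x / 2 := by positivity
  unfold besselJ besselEntire
  rw [← tsum_mul_left]
  refine tsum_congr fun m => ?_
  rw [Real.rpow_add hx2, Real.rpow_mul hx2.le, Real.rpow_natCast]
  norm_num [div_pow]
  ring

/-- The Liouville normal form `2^ν √x J_ν(x)`. -/
noncomputable def besselLiouville (ν x : ℝ) : ℝ :=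
  x ^ (ν + 1 / 2) * besselEntire ν (x ^ 2 / 4)

/-- The derivative of `besselLiouville`. -/
noncomputable def besselLiouvilleDeriv (ν x : ℝ) : ℝ :=
  (ν + 1 / 2) * x ^ (ν - 1 / 2) * besselEntire ν (x ^ 2 / 4) -
    x ^ (ν + 3 / 2) / 2 * besselEntire (ν + 1) (x ^ 2 / 4)

lemma hasDerivAt_besselEntire_sq {μ : ℝ} (hμ : -1 < μ) (x : ℝ) :
    HasDerivAt (fun x => besselEntire μ (x ^ 2 / 4))
      (-besselEntire (μ + 1) (x ^ 2 / 4) * (x / 2)) x := by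
  have h : HasDerivAt (fun x : ℝ => x ^ 2 / 4) (x / 2) x := by
    refine ((hasDerivAt_pow 2 x).div_const 4).congr_deriv ?_
    norm_num
    ring
  exact (hasDerivAt_besselEntire hμ (x ^ 2 / 4)).comp x h

lemma hasDerivAt_besselLiouville {ν : ℝ} (hν : -1 < ν) {x : ℝ} (hx : 0 < x) :
    HasDerivAt (besselLiouville ν) (besselLiouvilleDeriv ν x) x := by
  have h := (Real.hasDerivAt_rpow_const (x := x) (p := ν + 1 / 2) (Or.inl hx.ne')).mul
    (hasDerivAt_besselEntire_sq hν x)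
  refine h.congr_deriv ?_
  unfold besselLiouvilleDeriv
  rw [show ν + 1 / 2 - 1 = ν - 1 / 2 by ring, show ν + 3 / 2 = ν + 1 / 2 + 1 by ring,
    Real.rpow_add_one hx.ne']
  ring

lemma hasDerivAt_besselLiouvilleDeriv {ν : ℝ} (hν : -1 < ν) {x : ℝ} (hx : 0 < x) :
    HasDerivAt (besselLiouvilleDeriv ν)
      (-(1 - (ν ^ 2 - 1 / 4) / x ^ 2) * besselLiouville ν x) x := by
  have h := (((Real.hasDerivAt_rpow_const (x := x) (p := ν - 1 / 2) (Or.inl hx.ne')).const_mul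
    (ν + 1 / 2)).mul (hasDerivAt_besselEntire_sq hν x)).sub
    (((Real.hasDerivAt_rpow_const (x := x) (p := ν + 3 / 2) (Or.inl hx.ne')).div_const 2).mul
    (hasDerivAt_besselEntire_sq (μ := ν + 1) (by linarith) x))
  refine h.congr_deriv ?_
  have hrec := besselEntire_recurrence hν (x ^ 2 / 4)
  unfold besselLiouville
  rw [hrec, show ν + 1 + 1 = ν + 2 by ring, show ν + 1 / 2 = ν - 1 / 2 - 1 + 1 + 1 by ring,
    show ν + 3 / 2 - 1 = ν - 1 / 2 - 1 + 1 + 1 by ring,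
    show ν + 3 / 2 = ν - 1 / 2 - 1 + 1 + 1 + 1 by ring,
    Real.rpow_add_one hx.ne' (ν - 1 / 2 - 1 + 1 + 1),
    Real.rpow_add_one hx.ne' (ν - 1 / 2 - 1 + 1), Real.rpow_add_one hx.ne' (ν - 1 / 2 - 1),
    show ν - 1 / 2 = ν - 1 / 2 - 1 + 1 by ring, Real.rpow_add_one hx.ne' (ν - 1 / 2 - 1)]
  rw [show ν - 1 / 2 - 1 + 1 - 1 = ν - 1 / 2 - 1 by ring]
  field_simp
  ring

lemma besselLiouville_eq (ν : ℝ) {x : ℝ} (hx : 0 < x) :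
    besselLiouville ν x = 2 ^ ν * (√x * besselJ ν x) := by
  rw [besselLiouville, besselJ_eq_besselEntire ν hx, Real.div_rpow hx.le (by norm_num),
    Real.rpow_add hx, ← Real.sqrt_eq_rpow]
  have : (2 : ℝ) ^ ν ≠ 0 := by positivity
  field_simp

lemma besselLiouvilleDeriv_of_zero (ν : ℝ) {x : ℝ} (hx : 0 < x) (h : besselJ ν x = 0) :
    besselLiouvilleDeriv ν x = -(2 ^ ν * (√x * besselJ (ν + 1) x)) := by
  rw [besselJ_eq_besselEntire ν hx] at h
  have h0 : besselEntire ν (x ^ 2 / 4) = 0 :=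
    (mul_eq_zero.1 h).resolve_left (by positivity)
  rw [besselLiouvilleDeriv, h0, besselJ_eq_besselEntire (ν + 1) hx,
    Real.div_rpow hx.le (by norm_num), show ν + 3 / 2 = ν + 1 + 1 / 2 by ring,
    Real.rpow_add hx (ν + 1), ← Real.sqrt_eq_rpow, Real.rpow_add_one (by norm_num : (2 : ℝ) ≠ 0)]
  have : (2 : ℝ) ^ ν ≠ 0 := by positivity
  field_simp
  ring

section Energy

/-- Comparison of the energy `u² + u'²` at two points, for solutions of `u'' + (1 - κ/x²)u = 0`. -/
lemma energy_comparison {κ : ℝ} {u v : ℝ → ℝ}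
    (hu : ∀ x, 0 < x → HasDerivAt u (v x) x)
    (hv : ∀ x, 0 < x → HasDerivAt v (-(1 - κ / x ^ 2) * u x) x)
    {a b : ℝ} (ha : 0 < a) (hab : a ≤ b) :
    u a ^ 2 + v a ^ 2 ≤ Real.exp (|κ| / a) * (u b ^ 2 + v b ^ 2) ∧
      u b ^ 2 + v b ^ 2 ≤ Real.exp (|κ| / a) * (u a ^ 2 + v a ^ 2) := by
  have hb : 0 < b := ha.trans_le hab
  have hder : ∀ s : ℝ, ∀ x, 0 < x →
      HasDerivAt (fun x => (u x ^ 2 + v x ^ 2) * Real.exp (s / x))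
        (Real.exp (s / x) / x ^ 2 * (2 * κ * u x * v x - s * (u x ^ 2 + v x ^ 2))) x := by
    intro s x hx
    have h1 := (((hu x hx).pow 2).add ((hv x hx).pow 2)).mul
      ((hasDerivAt_inv hx.ne').const_mul s).exp
    refine (h1.congr_deriv ?_).congr_of_eventuallyEq (Eventually.of_forall fun y => ?_)
    · simp only [Pi.add_apply, Pi.pow_apply, ← div_eq_mul_inv]
      field_simp
      ring
    · simp [div_eq_mul_inv]
  have hk : ∀ x, |2 * κ * u x * v x| ≤ |κ| * (u x ^ 2 + v x ^ 2) := by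
    intro x
    have h2 : |2 * u x * v x| ≤ u x ^ 2 + v x ^ 2 :=
      abs_le.2 ⟨by nlinarith [sq_nonneg (u x + v x)], by nlinarith [sq_nonneg (u x - v x)]⟩
    calc |2 * κ * u x * v x| = |κ| * |2 * u x * v x| := by rw [← abs_mul]; congr 1; ring
      _ ≤ _ := by gcongr
  have hint : interior (Ioi (0 : ℝ)) = Ioi 0 := isOpen_Ioi.interior_eq
  have hmono : MonotoneOn (fun x => (u x ^ 2 + v x ^ 2) * Real.exp (-|κ| / x)) (Ioi 0) := by
    refine monotoneOn_of_hasDerivWithinAt_nonneg (convex_Ioi 0)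
      (fun x hx => (hder _ x hx).continuousAt.continuousWithinAt)
      (fun x hx => (hder _ x (by rwa [hint] at hx)).hasDerivWithinAt) fun x hx => ?_
    have := (abs_le.1 (hk x)).1
    refine mul_nonneg (by positivity) (by linarith)
  have hanti : AntitoneOn (fun x => (u x ^ 2 + v x ^ 2) * Real.exp (|κ| / x)) (Ioi 0) := by
    refine antitoneOn_of_hasDerivWithinAt_nonpos (convex_Ioi 0)
      (fun x hx => (hder _ x hx).continuousAt.continuousWithinAt)
      (fun x hx => (hder _ x (by rwa [hint] at hx)).hasDerivWithinAt) fun x hx => ?_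
    have := (abs_le.1 (hk x)).2
    exact mul_nonpos_of_nonneg_of_nonpos (by positivity) (by linarith)
  have h1 := hmono ha hb hab
  have h2 := hanti ha hb hab
  simp only [neg_div, Real.exp_neg] at h1 h2
  have hEa : 0 ≤ u a ^ 2 + v a ^ 2 := by positivity
  have hEb : 0 ≤ u b ^ 2 + v b ^ 2 := by positivity
  have hexp : 1 ≤ Real.exp (|κ| / b) := Real.one_le_exp (by positivity)
  constructor
  · have h3 : (u b ^ 2 + v b ^ 2) * (Real.exp (|κ| / b))⁻¹ ≤ u b ^ 2 + v b ^ 2 :=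
      mul_le_of_le_one_right hEb (inv_le_one_of_one_le₀ hexp)
    have h4 := h1.trans h3
    rw [← div_eq_mul_inv, div_le_iff₀ (Real.exp_pos _)] at h4
    linarith
  · have h3 := (le_mul_of_one_le_right hEb hexp).trans h2
    linarith

/-- Lower bound for the distance between two zeros of a solution of `u'' + (1 - κ/x²)u = 0`. -/
lemma exists_zero_gap {κ : ℝ} {u v : ℝ → ℝ}
    (hu : ∀ x, 0 < x → HasDerivAt u (v x) x)
    (hv : ∀ x, 0 < x → HasDerivAt v (-(1 - κ / x ^ 2) * u x) x) {r : ℝ} (hr : 0 < r) :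
    ∃ c : ℝ, 0 < c ∧ ∀ a b, r ≤ a → a < b → u a = 0 → u b = 0 → v a ≠ 0 → c ≤ b - a := by
  set K := Real.exp (|κ| / r)
  have hK : 1 ≤ K := Real.one_le_exp (by positivity)
  set Q := 1 + |κ| / r ^ 2
  have hQ : 0 < Q := by positivity
  refine ⟨1 / (Q * K), by positivity, fun a b hra hab hua hub hva => ?_⟩
  have ha : 0 < a := hr.trans_le hra
  obtain ⟨c, hc, hvc⟩ := exists_hasDerivAt_eq_zero hab
    (fun x hx => (hu x (ha.trans_le hx.1)).continuousAt.continuousWithinAt)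
    (hua.trans hub.symm) (fun x hx => hu x (ha.trans hx.1))
  have hbound : ∀ x ∈ Icc a c, ‖-(1 - κ / x ^ 2) * u x‖ ≤ Q * (K * |v a|) := by
    intro x hx
    have hx0 : 0 < x := ha.trans_le hx.1
    have h1 := (energy_comparison hu hv ha hx.1).2
    rw [hua] at h1
    have hexp : Real.exp (|κ| / a) ≤ K := Real.exp_le_exp.2 (by gcongr)
    have h2 : |u x| ≤ K * |v a| := by
      refine abs_le_of_sq_le_sq ?_ (by positivity)
      rw [mul_pow, sq_abs]
      have : Real.exp (|κ| / a) * v a ^ 2 ≤ K ^ 2 * v a ^ 2 := by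
        gcongr; nlinarith
      nlinarith [sq_nonneg (v x)]
    have h3 : |1 - κ / x ^ 2| ≤ Q := by
      calc |1 - κ / x ^ 2| ≤ |1| + |κ / x ^ 2| := abs_sub _ _
        _ = 1 + |κ| / x ^ 2 := by rw [abs_one, abs_div, abs_of_nonneg (sq_nonneg x)]
        _ ≤ Q := by simp only [Q]; gcongr; exact hra.trans hx.1
    rw [norm_mul, norm_neg, Real.norm_eq_abs, Real.norm_eq_abs]
    gcongr
  have hmv := (convex_Icc a c).norm_image_sub_le_of_norm_hasDerivWithin_le
    (fun x hx => (hv x (ha.trans_le hx.1)).hasDerivWithinAt) hbound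
    (left_mem_Icc.2 hc.1.le) (right_mem_Icc.2 hc.1.le)
  rw [hvc, zero_sub, norm_neg, Real.norm_eq_abs, Real.norm_of_nonneg (by linarith [hc.1])] at hmv
  have hva' : 0 < |v a| := abs_pos.2 hva
  have h1 : 1 ≤ Q * K * (c - a) := by
    by_contra! hlt
    nlinarith
  rw [div_le_iff₀ (by positivity)]
  have : Q * K * (c - a) ≤ Q * K * (b - a) := by gcongr; exact hc.2.le
  linarith

end Energy

lemma IsPositiveZerosOfBesselJ.besselLiouville_eq_zero {ν : ℝ} {Λ : ℕ → ℝ}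
    (hΛ : IsPositiveZerosOfBesselJ ν Λ) (n : ℕ) : besselLiouville ν (Λ n) = 0 := by
  rw [besselLiouville_eq ν (hΛ.2.1 n), hΛ.2.2.1 n, mul_zero, mul_zero]

lemma IsPositiveZerosOfBesselJ.besselLiouvilleDeriv_ne_zero {ν : ℝ} (hν : -1 < ν) {Λ : ℕ → ℝ}
    (hΛ : IsPositiveZerosOfBesselJ ν Λ) (n : ℕ) : besselLiouvilleDeriv ν (Λ n) ≠ 0 := by
  intro h0
  have hlt : Λ n < Λ (n + 1) := hΛ.1 n.lt_succ_self
  set x := (Λ n + Λ (n + 1)) / 2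
  have hx1 : Λ n < x := by simp only [x]; linarith
  have hx2 : x < Λ (n + 1) := by simp only [x]; linarith
  have hx0 : 0 < x := (hΛ.2.1 n).trans hx1
  have h := (energy_comparison (fun x hx => hasDerivAt_besselLiouville hν hx)
    (fun x hx => hasDerivAt_besselLiouvilleDeriv hν hx) (hΛ.2.1 n) hx1.le).2
  rw [h0, hΛ.besselLiouville_eq_zero n] at h
  have hux : besselLiouville ν x = 0 := by
    have := sq_nonneg (besselLiouvilleDeriv ν x)
    have := sq_nonneg (besselLiouville ν x)
    refine pow_eq_zero_iff two_ne_zero |>.1 ?_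
    norm_num at h
    linarith
  rw [besselLiouville_eq ν hx0] at hux
  have hJ : besselJ ν x = 0 := by
    have h1 : (2 : ℝ) ^ ν ≠ 0 := by positivity
    have h2 : √x ≠ 0 := by positivity
    simpa [h1, h2] using hux
  obtain ⟨m, hm⟩ := hΛ.2.2.2 x hx0 hJ
  rw [← hm] at hx1 hx2
  have := hΛ.1.lt_iff_lt.1 hx1
  have := hΛ.1.lt_iff_lt.1 hx2
  omega

lemma IsPositiveZerosOfBesselJ.exists_linear_lower_bound {ν : ℝ} (hν : -1 < ν) {Λ : ℕ → ℝ}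
    (hΛ : IsPositiveZerosOfBesselJ ν Λ) : ∃ c : ℝ, 0 < c ∧ ∀ n : ℕ, c * (n + 1) ≤ Λ n := by
  obtain ⟨c, hc, hgap⟩ := exists_zero_gap (fun x hx => hasDerivAt_besselLiouville hν hx)
    (fun x hx => hasDerivAt_besselLiouvilleDeriv hν hx) (hΛ.2.1 0)
  refine ⟨min c (Λ 0), lt_min hc (hΛ.2.1 0), fun n => ?_⟩
  induction n with
  | zero => simp
  | succ k ih =>
    have := hgap (Λ k) (Λ (k + 1)) (hΛ.1.monotone k.zero_le) (hΛ.1 k.lt_succ_self)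
      (hΛ.besselLiouville_eq_zero k) (hΛ.besselLiouville_eq_zero (k + 1))
      (hΛ.besselLiouvilleDeriv_ne_zero hν k)
    have := min_le_left c (Λ 0)
    push_cast
    linarith

lemma IsPositiveZerosOfBesselJ.summable_inv_sq {ν : ℝ} (hν : -1 < ν) {Λ : ℕ → ℝ}
    (hΛ : IsPositiveZerosOfBesselJ ν Λ) : Summable fun n => (Λ n ^ 2)⁻¹ := by
  obtain ⟨c, hc, h⟩ := hΛ.exists_linear_lower_bound hν
  have hs : Summable fun n : ℕ => (c ^ 2)⁻¹ * (((n + 1 : ℕ) : ℝ) ^ 2)⁻¹ :=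
    ((summable_nat_add_iff 1).2 (Real.summable_nat_pow_inv.2 one_lt_two)).mul_left _
  refine hs.of_nonneg_of_le (fun n => by positivity) fun n => ?_
  rw [← mul_inv, ← mul_pow]
  push_cast
  gcongr
  exact h n

lemma IsPositiveZerosOfBesselJ.exists_abs_phiFB_le {ν : ℝ} (hν : -(1 / 2 : ℝ) < ν) {Λ : ℕ → ℝ}
    (hΛ : IsPositiveZerosOfBesselJ ν Λ) :
    ∃ A : ℝ, 0 ≤ A ∧ ∀ n : ℕ, ∀ x, 1 / 4 ≤ x → x < 1 → |phiFB ν Λ n x| ≤ A / √(Λ n) := by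
  set K := Real.exp (|ν ^ 2 - 1 / 4| / (Λ 0 / 4))
  have hK : 0 < K := Real.exp_pos _
  refine ⟨√2 * √K * (1 / 4 : ℝ) ^ (-(ν + 1 / 2)), by positivity, fun n x hx hx1 => ?_⟩
  have hx0 : 0 < x := by linarith
  have hl : 0 < Λ n := hΛ.2.1 n
  have hl0 : 0 < Λ 0 := hΛ.2.1 0
  have hlx : 0 < Λ n * x := by positivity
  have hle : Λ 0 / 4 ≤ Λ n * x := by
    have : Λ 0 ≤ Λ n := hΛ.1.monotone n.zero_le
    nlinarith
  have hE := (energy_comparison (fun x hx => hasDerivAt_besselLiouville (by linarith) hx)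
    (fun x hx => hasDerivAt_besselLiouvilleDeriv (ν := ν) (by linarith) hx) hlx
    (mul_le_of_le_one_right hl.le hx1.le)).1
  rw [hΛ.besselLiouville_eq_zero n, besselLiouvilleDeriv_of_zero ν hl (hΛ.2.2.1 n),
    besselLiouville_eq ν hlx] at hE
  have hexp : Real.exp (|ν ^ 2 - 1 / 4| / (Λ n * x)) ≤ K := Real.exp_le_exp.2 (by gcongr)
  have h2 : (0 : ℝ) < 2 ^ ν := by positivity
  set J := besselJ ν (Λ n * x)
  set J' := besselJ (ν + 1) (Λ n)
  have hsq : (√x * J) ^ 2 ≤ K * J' ^ 2 := by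
    have h3 : (2 ^ ν * (√(Λ n * x) * J)) ^ 2 ≤ K * (2 ^ ν * (√(Λ n) * J')) ^ 2 := by
      have := mul_le_mul_of_nonneg_right hexp (sq_nonneg (2 ^ ν * (√(Λ n) * J')))
      have := sq_nonneg (besselLiouvilleDeriv ν (Λ n * x))
      rw [zero_pow two_ne_zero, zero_add, neg_sq] at hE
      linarith
    rw [Real.sqrt_mul hl.le] at h3
    have hpos : 0 < (2 ^ ν * √(Λ n)) ^ 2 := by positivity
    refine le_of_mul_le_mul_left ?_ hpos
    linarith
  have habs : √x * |J| ≤ √K * |J'| := by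
    have := Real.sqrt_le_sqrt hsq
    rwa [Real.sqrt_mul hK.le, Real.sqrt_sq_eq_abs, Real.sqrt_sq_eq_abs, abs_mul,
      abs_of_nonneg (Real.sqrt_nonneg x)] at this
  have hxr : x ^ (-ν) = √x * x ^ (-(ν + 1 / 2)) := by
    rw [Real.sqrt_eq_rpow, ← Real.rpow_add hx0]; congr 1; ring
  have hxm : x ^ (-(ν + 1 / 2)) ≤ (1 / 4 : ℝ) ^ (-(ν + 1 / 2)) :=
    Real.rpow_le_rpow_of_nonpos (by norm_num) hx (by linarith)
  have hphi : |phiFB ν Λ n x| =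
      √2 / √(Λ n) * (√x * |J| / |J'|) * x ^ (-(ν + 1 / 2)) := by
    unfold phiFB
    rw [hxr]
    simp only [abs_mul, abs_div, abs_abs, abs_of_pos hl, abs_of_nonneg (Real.sqrt_nonneg _),
      abs_of_pos (Real.rpow_pos_of_pos hx0 _)]
    have hs : √(Λ n) * √(Λ n) = Λ n := Real.mul_self_sqrt hl.le
    have hs0 : √(Λ n) ≠ 0 := by positivity
    have : √(Λ n) / Λ n = 1 / √(Λ n) := by
      rw [div_eq_div_iff hl.ne' hs0]; linarith
    calc √2 / (Λ n * |J'|) * √(Λ n) * |J| * (√x * x ^ (-(ν + 1 / 2)))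
        = √2 * (√(Λ n) / Λ n) * (√x * |J| / |J'|) * x ^ (-(ν + 1 / 2)) := by
          simp only [div_eq_mul_inv, mul_inv]; ring
      _ = _ := by rw [this]; ring
  rw [hphi]
  calc √2 / √(Λ n) * (√x * |J| / |J'|) * x ^ (-(ν + 1 / 2))
      ≤ √2 / √(Λ n) * √K * (1 / 4 : ℝ) ^ (-(ν + 1 / 2)) := by
        gcongr
        exact div_le_of_le_mul₀ (abs_nonneg _) (Real.sqrt_nonneg _) habs
    _ = _ := by ring

/-- Away from the origin, the Poisson kernel is `O(1/t)`. -/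
lemma IsPositiveZerosOfBesselJ.exists_abs_pKer_le {ν : ℝ} (hν : -(1 / 2 : ℝ) < ν) {Λ : ℕ → ℝ}
    (hΛ : IsPositiveZerosOfBesselJ ν Λ) :
    ∃ B : ℝ, 0 < B ∧ ∀ t, 0 < t → ∀ x, 1 / 4 ≤ x → x < 1 → ∀ y, 1 / 4 ≤ y → y < 1 →
      |pKer ν Λ t x y| ≤ B / t := by
  obtain ⟨A, hA, hphi⟩ := hΛ.exists_abs_phiFB_le hν
  have hs := hΛ.summable_inv_sq (by linarith)
  have hT : 0 ≤ ∑' n, (Λ n ^ 2)⁻¹ := tsum_nonneg fun n => by positivity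
  refine ⟨A ^ 2 * (∑' n, (Λ n ^ 2)⁻¹) + 1, by positivity, fun t ht x hx hx1 y hy hy1 => ?_⟩
  have hterm : ∀ n, ‖Real.exp (-t * Λ n) * phiFB ν Λ n x * phiFB ν Λ n y‖ ≤
      A ^ 2 / t * (Λ n ^ 2)⁻¹ := by
    intro n
    have hl : 0 < Λ n := hΛ.2.1 n
    have he : Real.exp (-t * Λ n) ≤ (t * Λ n)⁻¹ := by
      rw [neg_mul, Real.exp_neg]
      gcongr
      linarith [Real.add_one_le_exp (t * Λ n)]
    rw [norm_mul, norm_mul, Real.norm_eq_abs, Real.norm_eq_abs, Real.norm_eq_abs, Real.abs_exp]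
    calc Real.exp (-t * Λ n) * |phiFB ν Λ n x| * |phiFB ν Λ n y|
        ≤ (t * Λ n)⁻¹ * (A / √(Λ n)) * (A / √(Λ n)) := by
          gcongr
          · exact hphi n x hx hx1
          · exact hphi n y hy hy1
      _ = (t * Λ n)⁻¹ * (A ^ 2 / (√(Λ n) * √(Λ n))) := by ring
      _ = A ^ 2 / t * (Λ n ^ 2)⁻¹ := by
          rw [Real.mul_self_sqrt hl.le]; field_simp
  have h := tsum_of_norm_bounded (hs.mul_left (A ^ 2 / t)).hasSum hterm
  rw [tsum_mul_left] at h
  refine h.trans ?_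
  rw [div_mul_eq_mul_div]
  gcongr
  linarith

lemma measurableSet_Istar2 (j : ℕ) : MeasurableSet (Istar2 j) :=
  measurableSet_Ioc.inter measurableSet_Ioo

lemma mem_Istar2_bounds {j : ℕ} (hj : 1 ≤ j) {x : ℝ} (hx : x ∈ Istar2 j) :
    1 / 4 ≤ x ∧ x < 1 := by
  have hp : (1 / 2 : ℝ) ^ j ≤ 1 / 2 := by
    simpa using pow_le_pow_of_le_one (by norm_num : (0 : ℝ) ≤ 1 / 2) (by norm_num) hj
  simp only [Istar2, starSet, pI, qI, pow_succ _ j, mem_inter_iff, mem_Ioc, mem_Ioo] at hx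
  exact ⟨by linarith [hx.1.1], hx.2.2⟩

lemma muMeas_ne_top {ν : ℝ} (hν : -(1 / 2 : ℝ) < ν) (s : Set ℝ) : muMeas ν s ≠ ∞ := by
  refine ne_top_of_le_ne_top ENNReal.one_ne_top ((measure_mono (subset_univ s)).trans ?_)
  rw [muMeas, withDensity_apply _ MeasurableSet.univ, setLIntegral_univ]
  calc ∫⁻ x in Ioo (0 : ℝ) 1, ENNReal.ofReal (x ^ (2 * ν + 1))
      ≤ ∫⁻ _ in Ioo (0 : ℝ) 1, 1 := by
        refine setLIntegral_mono measurable_const fun x hx => ?_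
        rw [ENNReal.ofReal_le_one]
        exact Real.rpow_le_one hx.1.le hx.2.le (by linarith)
    _ = 1 := by simp

/-- The maximal operator `sup_{μ(I_j**)<t<1} |𝒫_t f|` is bounded on `L¹(I_j**, μ)`,
uniformly in `j ≥ 1` (Lemma 4.2). -/
theorem maximal_middle_time_L1_bounded_on_Istar2 (ν : ℝ) (hν : -(1/2 : ℝ) < ν)
    (Λ : ℕ → ℝ) (hΛ : IsPositiveZerosOfBesselJ ν Λ) :
    ∃ C : ℝ, 0 < C ∧
      ∀ j : ℕ, 1 ≤ j → ∀ f : ℝ → ℝ,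
        Function.support f ⊆ Istar2 j → Integrable f (muMeas ν) →
        ∫⁻ x in Istar2 j,
            (⨆ t : {t : ℝ // (muMeas ν (Istar2 j)).toReal < t ∧ t < 1},
              (‖∫ y, pKer ν Λ t.1 x y * f y ∂(muMeas ν)‖₊ : ℝ≥0∞)) ∂(muMeas ν)
          ≤ ENNReal.ofReal C * ∫⁻ y in Istar2 j, ‖f y‖₊ ∂(muMeas ν) := by
  obtain ⟨B, hB, hker⟩ := hΛ.exists_abs_pKer_le hν
  refine ⟨B, hB, fun j hj f hf _ => ?_⟩
  set μ := muMeas ν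
  set S := Istar2 j
  have hS : MeasurableSet S := measurableSet_Istar2 j
  have hfin : μ S ≠ ∞ := muMeas_ne_top hν S
  rcases eq_or_ne (μ S) 0 with h0 | h0
  · rw [setLIntegral_measure_zero S _ h0]
    exact zero_le
  have hm : 0 < (μ S).toReal := ENNReal.toReal_pos h0 hfin
  set N := ∫⁻ y in S, ‖f y‖₊ ∂μ
  have hpt : ∀ x ∈ S, (⨆ t : {t : ℝ // (μ S).toReal < t ∧ t < 1},
      (‖∫ y, pKer ν Λ t.1 x y * f y ∂μ‖₊ : ℝ≥0∞)) ≤ ENNReal.ofReal (B / (μ S).toReal) * N := by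
    intro x hx
    refine iSup_le fun ⟨t, ht, _⟩ => ?_
    have hsupp : ∀ y, y ∉ S → pKer ν Λ t x y * f y = 0 := fun y hy => by
      rw [Function.notMem_support.1 fun h => hy (hf h), mul_zero]
    rw [← setIntegral_eq_integral_of_forall_compl_eq_zero hsupp]
    refine (enorm_integral_le_lintegral_enorm _).trans ?_
    rw [← lintegral_const_mul' _ _ ENNReal.ofReal_ne_top]
    refine setLIntegral_mono' hS fun y hy => ?_
    obtain ⟨hx1, hx2⟩ := mem_Istar2_bounds hj hx
    obtain ⟨hy1, hy2⟩ := mem_Istar2_bounds hj hy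
    rw [enorm_mul]
    refine mul_le_mul_left ?_ _
    rw [← ofReal_norm, Real.norm_eq_abs]
    refine ENNReal.ofReal_le_ofReal ?_
    refine (hker t (hm.trans ht) x hx1 hx2 y hy1 hy2).trans ?_
    gcongr
  calc _ ≤ ∫⁻ _ in S, ENNReal.ofReal (B / (μ S).toReal) * N ∂μ := setLIntegral_mono' hS hpt
    _ = ENNReal.ofReal (B / (μ S).toReal) * μ S * N := by rw [setLIntegral_const]; ring
    _ = ENNReal.ofReal B * N := by
      nth_rewrite 2 [← ENNReal.ofReal_toReal hfin]
      rw [← ENNReal.ofReal_mul (by positivity), div_mul_cancel₀ _ hm.ne']
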